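/- Let T ⊆ ℝ⁵ be the set of points (x, y, z₁, z₂, z₃) satisfying 0 ≤ x ≤ 1, 0 ≤ y ≤ 1, x ≤ z₁ < 1 + x, y ≤ z₁ < 1 + y, 6x ≤ z₂ < 1 + 6x, 6y ≤ z₂ < 1 + 6y, 5x ≤ z₃ < 1 + 5x, and 5y ≤ z₃ < 1 + 5y. Then the 5-dimensional Lebesgue measure (volume) of T equals 95/864. -/

import Mathlib

open MeasureTheory

/-- The F-signature polytope for B_R(J,J), J = (xy⁶z⁵), exponent data a = b = (1,6,5):
    points (x, y, z₁, z₂, z₃) ∈ ℝ⁵ with 0 ≤ x ≤ 1, 0 ≤ y ≤ 1, x ≤ z₁ < 1+x, y ≤ z₁ < 1+y,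
    6x ≤ z₂ < 1+6x, 6y ≤ z₂ < 1+6y, 5x ≤ z₃ < 1+5x, 5y ≤ z₃ < 1+5y. -/
def T : Set (ℝ × ℝ × ℝ × ℝ × ℝ) :=
  {p | 0 ≤ p.1 ∧ p.1 ≤ 1 ∧ 0 ≤ p.2.1 ∧ p.2.1 ≤ 1 ∧
       p.1 ≤ p.2.2.1 ∧ p.2.2.1 < 1 + p.1 ∧
       p.2.1 ≤ p.2.2.1 ∧ p.2.2.1 < 1 + p.2.1 ∧
       6 * p.1 ≤ p.2.2.2.1 ∧ p.2.2.2.1 < 1 + 6 * p.1 ∧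
       6 * p.2.1 ≤ p.2.2.2.1 ∧ p.2.2.2.1 < 1 + 6 * p.2.1 ∧
       5 * p.1 ≤ p.2.2.2.2 ∧ p.2.2.2.2 < 1 + 5 * p.1 ∧
       5 * p.2.1 ≤ p.2.2.2.2 ∧ p.2.2.2.2 < 1 + 5 * p.2.1}

/-- The volume of the fibre of `T` over two points at distance `d`. -/
noncomputable def fibreVolume (d : ℝ) : ℝ := max 0 (1 - 6 * d) * ((1 - 5 * d) * (1 - d))

lemma continuous_fibreVolume : Continuous fibreVolume := by
  unfold fibreVolume
  fun_prop

lemma fibreVolume_of_le {d : ℝ} (h : d ≤ 1 / 6) :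
    fibreVolume d = (1 - 6 * d) * ((1 - 5 * d) * (1 - d)) := by
  rw [fibreVolume, max_eq_right (by linarith)]

lemma fibreVolume_of_ge {d : ℝ} (h : 1 / 6 ≤ d) : fibreVolume d = 0 := by
  rw [fibreVolume, max_eq_left (by linarith), zero_mul]

lemma fibreVolume_nonneg (d : ℝ) : 0 ≤ fibreVolume d := by
  rcases le_total d (1 / 6) with h | h
  · rw [fibreVolume_of_le h]
    exact mul_nonneg (by linarith) (mul_nonneg (by linarith) (by linarith))
  · rw [fibreVolume_of_ge h]

lemma ofReal_fibreVolume (d : ℝ) :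
    ENNReal.ofReal (1 - d) * (ENNReal.ofReal (1 - 6 * d) * ENNReal.ofReal (1 - 5 * d)) =
      ENNReal.ofReal (fibreVolume d) := by
  rcases le_total d (1 / 6) with h | h
  · rw [fibreVolume_of_le h, ← ENNReal.ofReal_mul (by linarith), ← ENNReal.ofReal_mul (by linarith)]
    congr 1
    ring
  · rw [fibreVolume_of_ge h, ENNReal.ofReal_of_nonpos (p := 1 - 6 * d) (by linarith)]
    simp

lemma volume_Ico_inter_Ico {c : ℝ} (hc : 0 ≤ c) (x y : ℝ) :
    volume (Set.Ico (c * x) (1 + c * x) ∩ Set.Ico (c * y) (1 + c * y)) =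
      ENNReal.ofReal (1 - c * |x - y|) := by
  rw [Set.Ico_inter_Ico, Real.volume_Ico]
  congr 1
  rcases le_total x y with h | h
  · have h' : c * x ≤ c * y := mul_le_mul_of_nonneg_left h hc
    rw [sup_eq_right.2 h', inf_eq_left.2 (by linarith), abs_of_nonpos (by linarith)]
    ring
  · have h' : c * y ≤ c * x := mul_le_mul_of_nonneg_left h hc
    rw [sup_eq_left.2 h', inf_eq_right.2 (by linarith), abs_of_nonneg (by linarith)]
    ring

lemma measurableSet_T : MeasurableSet T := by
  unfold T
  simp only [Set.ofPred_and]
  repeat' apply MeasurableSet.inter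
  all_goals first
    | exact measurableSet_le (by fun_prop) (by fun_prop)
    | exact measurableSet_lt (by fun_prop) (by fun_prop)

lemma volume_fibre (x y : ℝ) :
    volume (Prod.mk y ⁻¹' (Prod.mk x ⁻¹' T)) =
      (Set.Icc (0 : ℝ) 1).indicator (fun x => (Set.Icc (0 : ℝ) 1).indicator
        (fun y => ENNReal.ofReal (fibreVolume |x - y|)) y) x := by
  by_cases hx : x ∈ Set.Icc (0 : ℝ) 1
  · by_cases hy : y ∈ Set.Icc (0 : ℝ) 1
    · rw [Set.indicator_of_mem hx, Set.indicator_of_mem hy, ← ofReal_fibreVolume]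
      have key : Prod.mk y ⁻¹' (Prod.mk x ⁻¹' T) =
          (Set.Ico (1 * x) (1 + 1 * x) ∩ Set.Ico (1 * y) (1 + 1 * y)) ×ˢ
          ((Set.Ico (6 * x) (1 + 6 * x) ∩ Set.Ico (6 * y) (1 + 6 * y)) ×ˢ
          (Set.Ico (5 * x) (1 + 5 * x) ∩ Set.Ico (5 * y) (1 + 5 * y))) := by
        ext ⟨a, b, c⟩
        simp only [T, Set.mem_preimage, Set.mem_ofPred_eq, Set.mem_prod, Set.mem_inter_iff,
          Set.mem_Ico, one_mul]
        have := hx.1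
        have := hx.2
        have := hy.1
        have := hy.2
        tauto
      rw [key, Measure.volume_eq_prod, Measure.prod_prod, Measure.volume_eq_prod,
        Measure.prod_prod, volume_Ico_inter_Ico (by norm_num), volume_Ico_inter_Ico (by norm_num),
        volume_Ico_inter_Ico (by norm_num), one_mul]
    · rw [Set.indicator_of_mem hx, Set.indicator_of_notMem hy]
      convert measure_empty (μ := (volume : Measure (ℝ × ℝ × ℝ)))
      ext p
      simp only [T, Set.mem_preimage, Set.mem_ofPred_eq, Set.mem_empty_iff_false, iff_false]
      exact fun h => hy ⟨h.2.2.1, h.2.2.2.1⟩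
  · rw [Set.indicator_of_notMem hx]
    convert measure_empty (μ := (volume : Measure (ℝ × ℝ × ℝ)))
    ext p
    simp only [T, Set.mem_preimage, Set.mem_ofPred_eq, Set.mem_empty_iff_false, iff_false]
    exact fun h => hx ⟨h.1, h.2.1⟩

lemma setLIntegral_Icc_ofReal {f : ℝ → ℝ} (hf : Continuous f) (h0 : ∀ x, 0 ≤ f x) :
    ∫⁻ x in Set.Icc (0 : ℝ) 1, ENNReal.ofReal (f x) = ENNReal.ofReal (∫ x in (0 : ℝ)..1, f x) := by
  rw [intervalIntegral.integral_of_le zero_le_one, ← integral_Icc_eq_integral_Ioc,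
    ofReal_integral_eq_lintegral_ofReal (hf.integrableOn_Icc) (Filter.Eventually.of_forall h0)]

lemma integral_abs_sub {f : ℝ → ℝ} (hf : Continuous f) {x : ℝ} (h0 : 0 ≤ x) (h1 : x ≤ 1) :
    ∫ y in (0 : ℝ)..1, f |x - y| = (∫ t in (0 : ℝ)..x, f t) + ∫ t in (0 : ℝ)..(1 - x), f t := by
  have hc : Continuous fun y => f |x - y| := by fun_prop
  rw [← intervalIntegral.integral_add_adjacent_intervals (b := x)
    (hc.intervalIntegrable _ _) (hc.intervalIntegrable _ _)]
  congr 1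
  · have : ∫ y in (0 : ℝ)..x, f |x - y| = ∫ y in (0 : ℝ)..x, f (x - y) := by
      refine intervalIntegral.integral_congr fun y hy => ?_
      rw [Set.uIcc_of_le h0] at hy
      simp only [abs_of_nonneg (sub_nonneg.2 hy.2)]
    rw [this, intervalIntegral.integral_comp_sub_left f x]
    simp
  · have : ∫ y in x..1, f |x - y| = ∫ y in x..1, f (y - x) := by
      refine intervalIntegral.integral_congr fun y hy => ?_
      rw [Set.uIcc_of_le h1] at hy
      simp only [abs_sub_comm x y, abs_of_nonneg (sub_nonneg.2 hy.1)]
    rw [this, intervalIntegral.integral_comp_sub_right f x]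
    simp

lemma integral_primitive {f : ℝ → ℝ} (hf : Continuous f) :
    ∫ x in (0 : ℝ)..1, ∫ t in (0 : ℝ)..x, f t = ∫ t in (0 : ℝ)..1, f t * (1 - t) := by
  have h := intervalIntegral.integral_mul_deriv_eq_deriv_mul (a := 0) (b := 1)
    (u := fun x => ∫ t in (0 : ℝ)..x, f t) (u' := f) (v := fun x => x - 1) (v' := fun _ => 1)
    (fun x _ => (hf.integral_hasStrictDerivAt 0 x).hasDerivAt)
    (fun x _ => (hasDerivAt_id x).sub_const 1)
    (hf.intervalIntegrable _ _) (continuous_const.intervalIntegrable _ _)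
  simp only [mul_one, sub_self, mul_zero, intervalIntegral.integral_same, zero_mul, zero_sub] at h
  rw [h, ← intervalIntegral.integral_neg]
  exact intervalIntegral.integral_congr fun t _ => by ring

lemma integral_integral_abs_sub {f : ℝ → ℝ} (hf : Continuous f) :
    ∫ x in (0 : ℝ)..1, ∫ y in (0 : ℝ)..1, f |x - y| = 2 * ∫ t in (0 : ℝ)..1, f t * (1 - t) := by
  have hF : Continuous fun x => ∫ t in (0 : ℝ)..x, f t :=
    intervalIntegral.continuous_primitive (fun a b => hf.intervalIntegrable a b) 0
  have h : ∫ x in (0 : ℝ)..1, ∫ y in (0 : ℝ)..1, f |x - y| =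
      ∫ x in (0 : ℝ)..1, ((∫ t in (0 : ℝ)..x, f t) + ∫ t in (0 : ℝ)..(1 - x), f t) := by
    refine intervalIntegral.integral_congr fun x hx => ?_
    rw [Set.uIcc_of_le zero_le_one] at hx
    exact integral_abs_sub hf hx.1 hx.2
  have hF' : Continuous fun x : ℝ => ∫ t in (0 : ℝ)..(1 - x), f t :=
    hF.comp (continuous_const.sub continuous_id)
  rw [h, intervalIntegral.integral_add (hF.intervalIntegrable _ _) (hF'.intervalIntegrable _ _),
    intervalIntegral.integral_comp_sub_left (fun x => ∫ t in (0 : ℝ)..x, f t) 1, sub_self, sub_zero,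
    integral_primitive hf]
  ring

lemma integral_fibreVolume_mul :
    ∫ t in (0 : ℝ)..1, fibreVolume t * (1 - t) = 95 / 1728 := by
  have hc : Continuous fun t => fibreVolume t * (1 - t) :=
    continuous_fibreVolume.mul (by fun_prop)
  rw [← intervalIntegral.integral_add_adjacent_intervals (b := 1 / 6)
    (hc.intervalIntegrable _ _) (hc.intervalIntegrable _ _)]
  have h₁ : ∫ t in (0 : ℝ)..(1 / 6), fibreVolume t * (1 - t) =
      ∫ t in (0 : ℝ)..(1 / 6), (1 - 13 * t + 53 * t ^ 2 - 71 * t ^ 3 + 30 * t ^ 4) := by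
    refine intervalIntegral.integral_congr fun t ht => ?_
    rw [Set.uIcc_of_le (by norm_num)] at ht
    simp only [fibreVolume_of_le ht.2]
    ring
  have h₂ : ∫ t in (1 / 6 : ℝ)..1, fibreVolume t * (1 - t) = ∫ t in (1 / 6 : ℝ)..1, 0 := by
    refine intervalIntegral.integral_congr fun t ht => ?_
    rw [Set.uIcc_of_le (by norm_num)] at ht
    simp only [fibreVolume_of_ge ht.1, zero_mul]
  have h₃ : ∫ t in (0 : ℝ)..(1 / 6), (1 - 13 * t + 53 * t ^ 2 - 71 * t ^ 3 + 30 * t ^ 4) =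
      95 / 1728 := by
    rw [intervalIntegral.integral_eq_sub_of_hasDerivAt
      (f := fun t => t - 13 / 2 * t ^ 2 + 53 / 3 * t ^ 3 - 71 / 4 * t ^ 4 + 6 * t ^ 5)]
    · norm_num
    · intro t _
      have := ((((hasDerivAt_id t).sub ((hasDerivAt_pow 2 t).const_mul (13 / 2))).add
        ((hasDerivAt_pow 3 t).const_mul (53 / 3))).sub
        ((hasDerivAt_pow 4 t).const_mul (71 / 4))).add ((hasDerivAt_pow 5 t).const_mul 6)
      refine this.congr_deriv ?_
      push_cast
      ring
    · exact Continuous.intervalIntegrable (by fun_prop) _ _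
  rw [h₁, h₂, h₃, intervalIntegral.integral_zero, add_zero]

/-- The volume of this F-signature polytope is 95/864. -/
theorem fsig_volume : volume T = 95 / 864 := by
  have hslice (x : ℝ) : volume (Prod.mk x ⁻¹' T) = (Set.Icc (0 : ℝ) 1).indicator
      (fun x => ENNReal.ofReal (∫ y in (0 : ℝ)..1, fibreVolume |x - y|)) x := by
    rw [Measure.volume_eq_prod, Measure.prod_apply (measurable_prodMk_left measurableSet_T)]
    simp only [volume_fibre]
    by_cases hx : x ∈ Set.Icc (0 : ℝ) 1
    · simp only [Set.indicator_of_mem hx]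
      rw [lintegral_indicator measurableSet_Icc]
      exact setLIntegral_Icc_ofReal
        (continuous_fibreVolume.comp (f := fun y => |x - y|) (by fun_prop))
        fun y => fibreVolume_nonneg _
    · simp only [Set.indicator_of_notMem hx, lintegral_zero]
  have hcont : Continuous fun x : ℝ => ∫ y in (0 : ℝ)..1, fibreVolume |x - y| :=
    intervalIntegral.continuous_parametric_intervalIntegral_of_continuous'
      (f := fun x y => fibreVolume |x - y|)
      (continuous_fibreVolume.comp (f := fun p : ℝ × ℝ => |p.1 - p.2|) (by fun_prop)) 0 1
  rw [Measure.volume_eq_prod, Measure.prod_apply measurableSet_T]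
  simp only [hslice]
  rw [lintegral_indicator measurableSet_Icc, setLIntegral_Icc_ofReal hcont fun x =>
      intervalIntegral.integral_nonneg zero_le_one fun y _ => fibreVolume_nonneg _,
    integral_integral_abs_sub continuous_fibreVolume, integral_fibreVolume_mul,
    show (2 * (95 / 1728) : ℝ) = 95 / 864 by norm_num, ENNReal.ofReal_div_of_pos (by norm_num)]
  norm_num
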